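/- Let ℓ ≥ 1 and a > a_1 ≥ a_2 ≥ … ≥ a_ℓ, and use in every reduced election with t nominees the scoring vector (a, …, a, a_1, a_2, …, a_ℓ) of length t. Let φ be a (2,2)-E3-SAT formula with clauses C_1, …, C_m over variables x_1, …, x_n. Construct the election with parties P = {p}, P_w = {w}, X_i = {x_i, x̄_i} for each i ∈ [n], and ℓ−1 further singleton parties whose members form the set D; and with 2n+2m+1 voters: one voter with order [rest] ≻ p ≻ D; for each i ∈ [n] two voters with order [rest] ≻ x_i ≻ x̄_i ≻ D; and for each j ∈ [m] two voters with order [rest] ≻ w ≻ y_j^1 ≻ y_j^2 ≻ y_j^3 ≻ D, where D stands for its elements in some fixed order and [rest] denotes all remaining candidates in an arbitrary order. Then, for every choice of these arbitrary orders, p is a necessary president in this election if and only if φ is unsatisfiable. -/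

import Mathlib

open scoped Classical

noncomputable section

/-- Candidates: `p`, `w`, a candidate for each literal `x_i` / `x̄_i`, and a set `D`
of `ℓ−1` dummies. -/
inductive VCand (n ℓ : ℕ) where
  | pp : VCand n ℓ
  | ww : VCand n ℓ
  | lit : Fin n → Bool → VCand n ℓ
  | dum : Fin (ℓ - 1) → VCand n ℓ
  deriving DecidableEq, Fintype

/-- Voters: one voter `v0`, two voters for each variable `i`, and two voters for
each clause `j`; `2n + 2m + 1` voters in total. -/
inductive VVoter (n m : ℕ) where
  | v0 : VVoter n m
  | wv : Fin n → Bool → VVoter n m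
  | vj : Fin m → Bool → VVoter n m
  deriving DecidableEq, Fintype

variable {n m ℓ : ℕ}

/-- For each voter, the index of the block of candidates a candidate belongs to in
that voter's preference order (blocks are linearly ordered; the order inside a block
is arbitrary).  `cl j k` is the `k`-th literal of clause `j`. -/
def vgrp (cl : Fin m → Fin 3 → Fin n × Bool) : VVoter n m → VCand n ℓ → ℕ
  | .v0, .pp => 1
  | .v0, .dum _ => 2
  | .v0, _ => 0
  | .wv i _, .lit x b => if x = i then (if b then 1 else 2) else 0
  | .wv _ _, .dum _ => 3
  | .wv _ _, _ => 0
  | .vj _ _, .ww => 1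
  | .vj j _, .lit x b =>
      if cl j 0 = (x, b) then 2
      else if cl j 1 = (x, b) then 3
      else if cl j 2 = (x, b) then 4
      else 0
  | .vj _ _, .dum _ => 5
  | .vj _ _, _ => 0

/-- Each candidate is sent to the index of its party. -/
def vrep : VCand n ℓ → Unit ⊕ Unit ⊕ Fin n ⊕ Fin (ℓ - 1)
  | .pp => Sum.inl ()
  | .ww => Sum.inr (Sum.inl ())
  | .lit x _ => Sum.inr (Sum.inr (Sum.inl x))
  | .dum d => Sum.inr (Sum.inr (Sum.inr d))

/-- The parties: `{p}`, `{w}`, `X_i = {x_i, x̄_i}`, and singleton dummy parties. -/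
def vparties (n ℓ : ℕ) : Finset (Finset (VCand n ℓ)) :=
  Finset.univ.image fun c => Finset.univ.filter fun c' => vrep c' = vrep c

/-- Score of `c` over the nominee set `C'` for the Veto-like scoring vector
`(a, …, a, a_1, …, a_ℓ)`: a voter ranking `b` nominees below `c` contributes `a`
points if `b ≥ ℓ` and `as b` points otherwise, where `as b = a_{ℓ−b}` (so `as 0`
is the last entry `a_ℓ` and `as (ℓ−1) = a_1`). -/
def vetoScore {C V : Type*} [Fintype V] (ℓ : ℕ) (a : ℤ) (as : ℕ → ℤ)
    (pref : V → C → C → Prop) (C' : Finset C) (c : C) : ℤ :=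
  ∑ v : V,
    (if ℓ ≤ (C'.filter fun c' => pref v c c').card then a
     else as ((C'.filter fun c' => pref v c c').card))

/-- `C'` contains exactly one nominee of each party of `Ps`. -/
def IsNomineeSet {C : Type*} (Ps : Finset (Finset C)) (C' : Finset C) : Prop :=
  ∀ Pt ∈ Ps, (C' ∩ Pt).card = 1

/-- `p` is a winner of every reduced election containing `p`. -/
def NecessaryPresidentVeto {C V : Type*} [Fintype V] (ℓ : ℕ) (a : ℤ) (as : ℕ → ℤ)
    (pref : V → C → C → Prop) (Ps : Finset (Finset C)) (p : C) : Prop :=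
  ∀ C' : Finset C, IsNomineeSet Ps C' → p ∈ C' →
    ∀ c ∈ C', vetoScore ℓ a as pref C' c ≤ vetoScore ℓ a as pref C' p

lemma card_inter_one {C : Type*} {inst : DecidableEq C} (A B : Finset C) :
    (A ∩ B).card = 1 ↔ ∃! c, c ∈ A ∧ c ∈ B := by
  rw [Finset.card_eq_one]
  simp only [Finset.ext_iff, Finset.mem_inter, Finset.mem_singleton]
  constructor
  · rintro ⟨y, h⟩
    exact ⟨y, (h y).2 rfl, fun z hz => (h z).1 hz⟩
  · rintro ⟨y, hy, hu⟩
    refine ⟨y, fun z => ⟨fun hz => hu z hz, ?_⟩⟩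
    rintro rfl
    exact hy

lemma vnom_iff {C' : Finset (VCand n ℓ)} :
    IsNomineeSet (vparties n ℓ) C' ↔ ∀ c, ∃! c', c' ∈ C' ∧ vrep c' = vrep c := by
  have hm : ∀ c y : VCand n ℓ, y ∈ (Finset.univ.filter fun c' => vrep c' = vrep c) ↔
      vrep y = vrep c := by
    intro c y
    rw [Finset.mem_filter]
    exact ⟨fun h => h.2, fun h => ⟨Finset.mem_univ _, h⟩⟩
  constructor
  · intro h c
    have h1 := (card_inter_one _ _).1 (h _ (Finset.mem_image.2 ⟨c, Finset.mem_univ _, rfl⟩))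
    simpa only [hm] using h1
  · intro h Pt hP
    obtain ⟨c, -, rfl⟩ := Finset.mem_image.1 hP
    rw [card_inter_one]
    simpa only [hm] using h c

/-- The set of dummies. -/
def vdums (n ℓ : ℕ) : Finset (VCand n ℓ) := Finset.univ.image VCand.dum

lemma vdums_card : (vdums n ℓ).card = ℓ - 1 := by
  unfold vdums
  rw [Finset.card_image_of_injective _ (fun x y h => by injection h)]
  simp

/-- Facts about the nominee sets. -/
lemma vnom_facts {C' : Finset (VCand n ℓ)} (h : IsNomineeSet (vparties n ℓ) C') :
    VCand.ww ∈ C' ∧ VCand.pp ∈ C' ∧ vdums n ℓ ⊆ C' ∧ (∀ x, ∃ b, VCand.lit x b ∈ C') ∧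
      (∀ x b b', VCand.lit x b ∈ C' → VCand.lit x b' ∈ C' → b = b') := by
  rw [vnom_iff] at h
  refine ⟨?_, ?_, ?_, ?_, ?_⟩
  · obtain ⟨y, ⟨hy, hr⟩, -⟩ := h .ww
    cases y <;> simp_all [vrep]
  · obtain ⟨y, ⟨hy, hr⟩, -⟩ := h .pp
    cases y <;> simp_all [vrep]
  · intro c hc
    obtain ⟨d, -, rfl⟩ := Finset.mem_image.1 hc
    obtain ⟨y, ⟨hy, hr⟩, -⟩ := h (.dum d)
    cases y <;> simp_all [vrep]
  · intro x
    obtain ⟨y, ⟨hy, hr⟩, -⟩ := h (.lit x true)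
    cases y with
    | lit z b =>
      simp only [vrep, Sum.inr.injEq, Sum.inl.injEq] at hr
      exact ⟨b, hr ▸ hy⟩
    | _ => simp [vrep] at hr
  · intro x b b' h1 h2
    have := (h (.lit x true)).unique ⟨h1, rfl⟩ ⟨h2, rfl⟩
    injection this

/-- The nominee set belonging to an assignment. -/
lemma vnom_exists (σ : Fin n → Bool) : ∃ C' : Finset (VCand n ℓ),
    IsNomineeSet (vparties n ℓ) C' ∧ ∀ x, VCand.lit x (σ x) ∈ C' := by
  obtain ⟨C', hl, ho⟩ : ∃ C' : Finset (VCand n ℓ),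
      (∀ x b, VCand.lit x b ∈ C' ↔ b = σ x) ∧
        ∀ c, (∀ x b, c ≠ VCand.lit x b) → c ∈ C' := by
    refine ⟨Finset.univ.filter fun c => ∀ x b, c = VCand.lit x b → b = σ x, ?_, ?_⟩
    · intro x b
      rw [Finset.mem_filter]
      constructor
      · intro h
        exact h.2 x b rfl
      · intro h
        refine ⟨Finset.mem_univ _, ?_⟩
        intro x' b' he
        injection he with h1 h2
        rw [← h1, ← h2, h]
    · intro c hc
      rw [Finset.mem_filter]
      exact ⟨Finset.mem_univ _, fun x b he => absurd he (hc x b)⟩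
  refine ⟨C', ?_, fun x => (hl x _).2 rfl⟩
  rw [vnom_iff]
  intro c
  cases c with
  | lit x b =>
    refine ⟨.lit x (σ x), ⟨(hl x _).2 rfl, rfl⟩, ?_⟩
    rintro y ⟨h1, h2⟩
    cases y with
    | lit z b' =>
      simp only [vrep, Sum.inr.injEq, Sum.inl.injEq] at h2
      rw [h2, (hl _ _).1 h1, h2]
    | _ => simp [vrep] at h2
  | _ =>
    refine ⟨_, ⟨ho _ (by intro x b h; cases h), rfl⟩, ?_⟩
    rintro y ⟨h1, h2⟩
    cases y <;> simp_all [vrep]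

/-- for every Veto-like scoring rule `(a, …, a, a_1, …, a_ℓ)` with
`a > a_1 ≥ … ≥ a_ℓ`, in the election constructed from a (2,2)-E3-SAT formula `φ`,
the candidate `p` is a necessary president iff `φ` is unsatisfiable. -/
theorem veto_rule_necessary_president_iff_unsat
    (n m ℓ : ℕ) (hℓ : 1 ≤ ℓ)
    (cl : Fin m → Fin 3 → Fin n × Bool)
    -- each clause consists of three distinct literals
    (hdist : ∀ j : Fin m, Function.Injective (cl j))
    -- each variable occurs exactly twice positively and twice negatively
    (hocc : ∀ (x : Fin n) (b : Bool),
      ((Finset.univ : Finset (Fin m × Fin 3)).filter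
        fun jk => cl jk.1 jk.2 = (x, b)).card = 2)
    -- the scoring vector: `a` on all but the last `ℓ` positions, then `a_1 ≥ … ≥ a_ℓ`
    (a : ℤ) (as : ℕ → ℤ)
    (hmono : ∀ i j : ℕ, i ≤ j → j < ℓ → as i ≤ as j)
    (htop : as (ℓ - 1) < a)
    -- the preference orders, consistent with the prescribed blocks
    (pref : VVoter n m → VCand n ℓ → VCand n ℓ → Prop)
    (hlin : ∀ v, IsStrictTotalOrder (VCand n ℓ) (pref v))
    (hord : ∀ v c c', vgrp cl v c < vgrp cl v c' → pref v c c') :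
    NecessaryPresidentVeto ℓ a as pref (vparties n ℓ) VCand.pp ↔
      ¬ ∃ σ : Fin n → Bool, ∀ j : Fin m, ∃ k : Fin 3, σ (cl j k).1 = (cl j k).2 := by
  have hirr : ∀ v c, ¬ pref v c c := fun v c => (hlin v).irrefl c
  have hasym : ∀ v c c', pref v c c' → ¬ vgrp cl v c' < vgrp cl v c := by
    intro v c c' h h'
    exact hirr v c ((hlin v).trans _ _ _ h (hord v _ _ h'))
  have has : ∀ i, i < ℓ → as i ≤ as (ℓ - 1) := fun i hi => hmono i (ℓ - 1) (by omega) (by omega)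
  -- full contribution
  have hA : ∀ (C' : Finset (VCand n ℓ)) v (c c' : VCand n ℓ), vdums n ℓ ⊆ C' → c' ∈ C' → c' ∉ vdums n ℓ →
      vgrp cl v c < vgrp cl v c' → (∀ d, vgrp cl v c < vgrp cl v (.dum d : VCand n ℓ)) →
      ℓ ≤ (C'.filter fun y => pref v c y).card := by
    intro C' v c c' hd hc' hnd hlt hdl
    have hsub : insert c' (vdums n ℓ) ⊆ C'.filter fun y => pref v c y := by
      intro y hy
      rcases Finset.mem_insert.1 hy with rfl | hy
      · exact Finset.mem_filter.2 ⟨hc', hord _ _ _ hlt⟩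
      · refine Finset.mem_filter.2 ⟨hd hy, ?_⟩
        obtain ⟨d, -, rfl⟩ := Finset.mem_image.1 hy
        exact hord _ _ _ (hdl d)
    have := Finset.card_le_card hsub
    rw [Finset.card_insert_of_notMem hnd, vdums_card] at this
    omega
  -- non-full contribution
  have hB : ∀ (C' : Finset (VCand n ℓ)) v c,
      (∀ y ∈ C', pref v c y → y ∈ vdums n ℓ) → (C'.filter fun y => pref v c y).card < ℓ := by
    intro C' v c h
    have : (C'.filter fun y => pref v c y) ⊆ vdums n ℓ := by
      intro y hy
      exact h y (Finset.mem_filter.1 hy).1 (Finset.mem_filter.1 hy).2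
    have := Finset.card_le_card this
    rw [vdums_card] at this
    omega
  have hdm : ∀ d : Fin (ℓ - 1), (VCand.dum d : VCand n ℓ) ∈ vdums n ℓ := fun d =>
    Finset.mem_image.2 ⟨d, Finset.mem_univ _, rfl⟩
  have hwd : (VCand.ww : VCand n ℓ) ∉ vdums n ℓ := by simp [vdums]
  have hld : ∀ x b, (VCand.lit x b : VCand n ℓ) ∉ vdums n ℓ := by simp [vdums]
  -- the score of `p`
  have hp0 : ∀ C' : Finset (VCand n ℓ), ∀ y ∈ C', pref .v0 .pp y → y ∈ vdums n ℓ := by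
    intro C' y _ h
    cases y with
    | pp => exact absurd h (hirr _ _)
    | ww => exact absurd (by simp [vgrp]) (hasym _ _ _ h)
    | lit x b => exact absurd (by simp [vgrp]) (hasym _ _ _ h)
    | dum d => exact hdm d
  have hscp : ∀ C' : Finset (VCand n ℓ), IsNomineeSet (vparties n ℓ) C' →
      vetoScore ℓ a as pref C' .pp =
        ∑ v : VVoter n m, if v = .v0 then as (ℓ - 1) else a := by
    intro C' hC'
    obtain ⟨hw, hp, hd, hl, hu⟩ := vnom_facts hC'
    unfold vetoScore
    refine Finset.sum_congr rfl fun v _ => ?_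
    cases v with
    | v0 =>
      have h1 := hB C' .v0 .pp (hp0 C')
      have h2 : vdums n ℓ ⊆ C'.filter fun y => pref .v0 .pp y := by
        intro y hy
        refine Finset.mem_filter.2 ⟨hd hy, ?_⟩
        obtain ⟨d, -, rfl⟩ := Finset.mem_image.1 hy
        exact hord _ _ _ (by simp [vgrp])
      have h3 := Finset.card_le_card h2
      rw [vdums_card] at h3
      rw [if_neg (by omega), if_pos rfl]
      congr 1
      omega
    | wv i b =>
      obtain ⟨b', hb'⟩ := hl i
      rw [if_neg (by simp : ¬ (VVoter.wv i b : VVoter n m) = .v0), if_pos]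
      exact hA C' _ _ _ hd hb' (hld _ _) (by cases b' <;> simp [vgrp]) (by simp [vgrp])
    | vj j b =>
      rw [if_neg (by simp : ¬ (VVoter.vj j b : VVoter n m) = .v0), if_pos]
      exact hA C' _ _ _ hd hw hwd (by simp [vgrp]) (by simp [vgrp])
  have hsum : ∀ v1 : VVoter n m, (∑ v : VVoter n m, if v = v1 then as (ℓ - 1) else a) =
      as (ℓ - 1) - a + ∑ v : VVoter n m, a := by
    intro v1
    have : ∀ v : VVoter n m, (if v = v1 then as (ℓ - 1) else a) =
        (if v = v1 then as (ℓ - 1) - a else 0) + a := by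
      intro v
      split_ifs <;> ring
    simp only [this, Finset.sum_add_distrib, Finset.sum_ite_eq', Finset.mem_univ, if_true]
  constructor
  · rintro hN ⟨σ, hσ⟩
    obtain ⟨C', hC', hmem⟩ := vnom_exists (ℓ := ℓ) σ
    obtain ⟨hw, hp, hd, hl, hu⟩ := vnom_facts hC'
    have h := hN C' hC' hp _ hw
    rw [hscp C' hC', hsum] at h
    have hw' : vetoScore ℓ a as pref C' .ww = ∑ v : VVoter n m, a := by
      unfold vetoScore
      refine Finset.sum_congr rfl fun v _ => ?_
      rw [if_pos]
      cases v with
      | v0 => exact hA C' _ _ .pp hd hp (by simp [vdums]) (by simp [vgrp]) (by simp [vgrp])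
      | wv i b =>
        obtain ⟨b', hb'⟩ := hl i
        exact hA C' _ _ _ hd hb' (hld _ _) (by cases b' <;> simp [vgrp]) (by simp [vgrp])
      | vj j b =>
        obtain ⟨k, hk⟩ := hσ j
        refine hA C' _ _ (.lit (cl j k).1 (cl j k).2) hd (hk ▸ hmem _) (hld _ _) ?_
          (by simp [vgrp])
        simp only [vgrp]
        fin_cases k
        · simp
        · simp only [Fin.mk_one, Prod.mk.eta]
          split_ifs <;> simp_all
        · simp only [Fin.reduceFinMk, Prod.mk.eta]
          split_ifs <;> simp_all
    omega
  · intro hun C' hC' hp c hc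
    obtain ⟨hw, -, hd, hl, hu⟩ := vnom_facts hC'
    have main : ∃ v1, ∀ y ∈ C', pref v1 c y → y ∈ vdums n ℓ := by
      cases c with
      | pp => exact ⟨.v0, hp0 C'⟩
      | ww =>
        push Not at hun
        obtain ⟨j, hj⟩ := hun fun x => decide (VCand.lit x true ∈ C')
        have hnot : ∀ k x b, VCand.lit x b ∈ C' → cl j k ≠ (x, b) := by
          intro k x b hx he
          apply hj k
          rw [he]
          cases b with
          | true => simpa using hx
          | false =>
            simp only [decide_eq_false_iff_not]
            intro ht
            exact absurd (hu x _ _ ht hx) (by simp)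
        refine ⟨.vj j true, fun y hy h => ?_⟩
        cases y with
        | pp => exact absurd (by simp [vgrp]) (hasym _ _ _ h)
        | ww => exact absurd h (hirr _ _)
        | lit x b =>
          refine absurd ?_ (hasym _ _ _ h)
          simp [vgrp, hnot 0 x b hy, hnot 1 x b hy, hnot 2 x b hy]
        | dum d => exact hdm d
      | lit x b =>
        refine ⟨.wv x true, fun y hy h => ?_⟩
        cases y with
        | pp => exact absurd (by cases b <;> simp [vgrp]) (hasym _ _ _ h)
        | ww => exact absurd (by cases b <;> simp [vgrp]) (hasym _ _ _ h)
        | lit z b' =>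
          by_cases hz : z = x
          · subst hz
            have := hu _ _ _ hc hy
            subst this
            exact absurd h (hirr _ _)
          · exact absurd (by cases b <;> simp [vgrp, hz]) (hasym _ _ _ h)
        | dum d => exact hdm d
      | dum d =>
        refine ⟨.v0, fun y hy h => ?_⟩
        cases y with
        | pp => exact absurd (by simp [vgrp]) (hasym _ _ _ h)
        | ww => exact absurd (by simp [vgrp]) (hasym _ _ _ h)
        | lit x b => exact absurd (by simp [vgrp]) (hasym _ _ _ h)
        | dum d => exact hdm d
    obtain ⟨v1, hv1⟩ := main
    rw [hscp C' hC', hsum, ← hsum v1]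
    unfold vetoScore
    refine Finset.sum_le_sum fun v _ => ?_
    by_cases hv : v = v1
    · subst hv
      have := hB C' v c hv1
      rw [if_neg (by omega), if_pos rfl]
      exact has _ this
    · rw [if_neg hv]
      split_ifs with h1
      · exact le_rfl
      · exact (has _ (by omega)).trans htop.le
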